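/- Let q, a be complex numbers with |q| < 1, |a| ≤ 1 (or more generally such that both series converge), and 1 - a q^n ≠ 0 for all n ≥ 1. Then ∑_{n=1}^∞ ( (-1)^{n-1} a^n q^{n(n+1)/2} ) / ( (1 - q^n) (aq;q)_n ) = ∑_{n=1}^∞ ( a^n q^n ) / (1 - q^n). -/

import Mathlib

/-- The finite q-Pochhammer symbol `(A;q)_n = (1-A)(1-Aq)⋯(1-Aq^{n-1})`. -/
noncomputable def qPoch (q A : ℂ) (n : ℕ) : ℂ := ∏ k ∈ Finset.range n, (1 - A * q ^ k)

/-- The infinite q-Pochhammer symbol `(A;q)_∞ = ∏_{k≥0} (1 - A q^k)`. -/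
noncomputable def qPochInf (q A : ℂ) : ℂ := ∏' k : ℕ, (1 - A * q ^ k)

open Filter Topology

/-- The `n`-th term of the alternating series in base `A`. -/
noncomputable def altTerm (q A : ℂ) (n : ℕ) : ℂ :=
  ((-1 : ℂ) ^ n * A ^ (n + 1) * q ^ ((n + 1) * (n + 2) / 2)) /
    ((1 - q ^ (n + 1)) * qPoch q (A * q) (n + 1))

/-- The `n`-th term of the Lambert series in base `A`. -/
noncomputable def lambertTerm (q A : ℂ) (n : ℕ) : ℂ :=
  A ^ (n + 1) * q ^ (n + 1) / (1 - q ^ (n + 1))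

lemma one_sub_norm_le_norm_one_sub_pow {q : ℂ} (hq : ‖q‖ < 1) (n : ℕ) :
    1 - ‖q‖ ≤ ‖1 - q ^ (n + 1)‖ := by
  have h1 : ‖(1 : ℂ)‖ - ‖q ^ (n + 1)‖ ≤ ‖1 - q ^ (n + 1)‖ := norm_sub_norm_le _ _
  have h2 : ‖q‖ ^ (n + 1) ≤ ‖q‖ := pow_le_of_le_one (norm_nonneg q) hq.le (Nat.succ_ne_zero n)
  rw [norm_one, norm_pow] at h1
  linarith

lemma one_sub_pow_succ_ne_zero {q : ℂ} (hq : ‖q‖ < 1) (n : ℕ) : 1 - q ^ (n + 1) ≠ 0 := by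
  have := one_sub_norm_le_norm_one_sub_pow hq n
  exact norm_pos_iff.mp (by linarith)

lemma qPoch_ne_zero {q A : ℂ} (hA : ∀ n : ℕ, 1 - A * q ^ n ≠ 0) (n : ℕ) : qPoch q A n ≠ 0 :=
  Finset.prod_ne_zero_iff.mpr fun k _ ↦ hA k

lemma qPoch_succ (q A : ℂ) (n : ℕ) : qPoch q A (n + 1) = qPoch q A n * (1 - A * q ^ n) :=
  Finset.prod_range_succ _ _

lemma qPoch_add (q A : ℂ) (m n : ℕ) :
    qPoch q A (m + n) = qPoch q A m * qPoch q (A * q ^ m) n := by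
  simp only [qPoch, Finset.prod_range_add, pow_add, mul_assoc]

lemma exists_norm_inv_qPoch_le {q A : ℂ} (hq : ‖q‖ < 1) (hA : ∀ n : ℕ, 1 - A * q ^ n ≠ 0) :
    ∃ K : ℝ, 0 ≤ K ∧ ∀ m n : ℕ, ‖(qPoch q (A * q ^ m) n)⁻¹‖ ≤ K := by
  have hs : Summable fun k : ℕ ↦ ‖-(A * q ^ k)‖ := by
    simpa only [norm_neg, norm_mul, norm_pow] using
      (summable_geometric_of_lt_one (norm_nonneg q) hq).mul_left ‖A‖
  have hlim : Tendsto (qPoch q A) atTop (𝓝 (∏' k : ℕ, (1 + -(A * q ^ k)))) := by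
    have := (multipliable_one_add_of_summable hs).tendsto_prod_tprod_nat
    simp only [← sub_eq_add_neg] at this ⊢
    exact this
  have hne : ∏' k : ℕ, (1 + -(A * q ^ k)) ≠ 0 :=
    tprod_one_add_ne_zero_of_summable (fun k ↦ by simpa only [← sub_eq_add_neg] using hA k) hs
  obtain ⟨C, hC⟩ := hlim.norm.bddAbove_range
  obtain ⟨D, hD⟩ := (hlim.inv₀ hne).norm.bddAbove_range
  have hC' (n : ℕ) : ‖qPoch q A n‖ ≤ C := hC ⟨n, rfl⟩
  have hD' (n : ℕ) : ‖(qPoch q A n)⁻¹‖ ≤ D := hD ⟨n, rfl⟩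
  have hC0 : 0 ≤ C := (norm_nonneg _).trans (hC' 0)
  have hD0 : 0 ≤ D := (norm_nonneg _).trans (hD' 0)
  refine ⟨C * D, by positivity, fun m n ↦ ?_⟩
  have h : (qPoch q (A * q ^ m) n)⁻¹ = qPoch q A m * (qPoch q A (m + n))⁻¹ := by
    rw [qPoch_add, mul_inv, mul_inv_cancel_left₀ (qPoch_ne_zero hA m)]
  rw [h, norm_mul]
  exact mul_le_mul (hC' m) (hD' _) (norm_nonneg _) hC0

lemma triangle_succ (n : ℕ) :
    (n + 1 + 1) * (n + 1 + 2) / 2 = (n + 1) * (n + 2) / 2 + (n + 2) := by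
  have h : (n + 1 + 1) * (n + 1 + 2) = (n + 1) * (n + 2) + (n + 2) * 2 := by ring
  rw [h, Nat.add_mul_div_right _ _ two_pos]

lemma le_triangle (n : ℕ) : n ≤ (n + 1) * (n + 2) / 2 := by
  rw [Nat.le_div_iff_mul_le two_pos]
  nlinarith

lemma norm_altTerm_le {q A : ℂ} {K : ℝ} (hq : ‖q‖ < 1) (hA : ‖A‖ ≤ 1) (hK0 : 0 ≤ K)
    (hK : ∀ n, ‖(qPoch q (A * q) n)⁻¹‖ ≤ K) (n : ℕ) :
    ‖altTerm q A n‖ ≤ ‖A‖ * (K / (1 - ‖q‖)) * ‖q‖ ^ n := by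
  have h1 : ‖A‖ ^ (n + 1) ≤ ‖A‖ := pow_le_of_le_one (norm_nonneg A) hA (Nat.succ_ne_zero n)
  have h2 : ‖q‖ ^ ((n + 1) * (n + 2) / 2) ≤ ‖q‖ ^ n :=
    pow_le_pow_of_le_one (norm_nonneg q) hq.le (le_triangle n)
  have h3 : ‖1 - q ^ (n + 1)‖⁻¹ ≤ (1 - ‖q‖)⁻¹ :=
    inv_anti₀ (by linarith) (one_sub_norm_le_norm_one_sub_pow hq n)
  have h4 := hK (n + 1)
  have h5 : 0 ≤ (1 - ‖q‖)⁻¹ := inv_nonneg.mpr (by linarith)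
  calc ‖altTerm q A n‖
      = ‖A‖ ^ (n + 1) * (‖(qPoch q (A * q) (n + 1))⁻¹‖ * ‖1 - q ^ (n + 1)‖⁻¹) *
          ‖q‖ ^ ((n + 1) * (n + 2) / 2) := by
        simp only [altTerm, norm_mul, norm_pow, norm_neg, norm_one, one_pow, norm_inv,
          div_eq_mul_inv, mul_inv]
        ring
    _ ≤ ‖A‖ * (K * (1 - ‖q‖)⁻¹) * ‖q‖ ^ n := by gcongr
    _ = _ := by rw [div_eq_mul_inv]

lemma norm_lambertTerm_le {q A : ℂ} (hq : ‖q‖ < 1) (hA : ‖A‖ ≤ 1) (n : ℕ) :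
    ‖lambertTerm q A n‖ ≤ ‖A‖ * (1 - ‖q‖)⁻¹ * ‖q‖ ^ n := by
  have h1 : ‖A‖ ^ (n + 1) ≤ ‖A‖ := pow_le_of_le_one (norm_nonneg A) hA (Nat.succ_ne_zero n)
  have h2 : ‖q‖ ^ (n + 1) ≤ ‖q‖ ^ n :=
    pow_le_pow_of_le_one (norm_nonneg q) hq.le (Nat.le_succ n)
  have h3 : ‖1 - q ^ (n + 1)‖⁻¹ ≤ (1 - ‖q‖)⁻¹ :=
    inv_anti₀ (by linarith) (one_sub_norm_le_norm_one_sub_pow hq n)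
  have h5 : 0 ≤ (1 - ‖q‖)⁻¹ := inv_nonneg.mpr (by linarith)
  calc ‖lambertTerm q A n‖ = ‖A‖ ^ (n + 1) * ‖1 - q ^ (n + 1)‖⁻¹ * ‖q‖ ^ (n + 1) := by
        simp only [lambertTerm, norm_mul, norm_pow, norm_inv, div_eq_mul_inv]
        ring
    _ ≤ _ := by gcongr

lemma altTerm_sub_altTerm_mul {q A : ℂ} (hq : ‖q‖ < 1) (hA : ∀ n : ℕ, 1 - A * q * q ^ n ≠ 0)
    (n : ℕ) :
    altTerm q A n - altTerm q (A * q) n =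
      altTerm q A n * (1 - q ^ (n + 1)) - altTerm q A (n + 1) * (1 - q ^ (n + 1 + 1)) := by
  have hshift : qPoch q (A * q) (n + 1) * (1 - A * q * q ^ (n + 1)) =
      (1 - A * q) * qPoch q (A * q * q) (n + 1) := by
    rw [← qPoch_succ, add_comm (n + 1) 1, qPoch_add]
    simp [qPoch]
  have h0 : 1 - A * q ≠ 0 := by simpa using hA 0
  have hP := qPoch_ne_zero hA (n + 1)
  have hn : 1 - A * q ^ (n + 2) ≠ 0 := by
    convert hA (n + 1) using 2
    ring
  have hinv : (qPoch q (A * q * q) (n + 1))⁻¹ =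
      (1 - A * q) / (qPoch q (A * q) (n + 1) * (1 - A * q * q ^ (n + 1))) := by
    rw [hshift, div_mul_eq_div_div, div_self h0, one_div]
  have h1 := one_sub_pow_succ_ne_zero hq n
  have h2 := one_sub_pow_succ_ne_zero hq (n + 1)
  have hmul : altTerm q (A * q) n = ((-1 : ℂ) ^ n * (A * q) ^ (n + 1) *
      q ^ ((n + 1) * (n + 2) / 2)) / (1 - q ^ (n + 1)) * (qPoch q (A * q * q) (n + 1))⁻¹ := by
    rw [altTerm, div_mul_eq_div_div, div_eq_mul_inv _ (qPoch _ _ _)]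
  have e : A * q * q ^ (n + 1) = A * q ^ (n + 2) := by ring
  rw [hmul, hinv, altTerm, altTerm, qPoch_succ q (A * q) (n + 1), triangle_succ, e]
  generalize qPoch q (A * q) (n + 1) = P at *
  generalize (n + 1) * (n + 2) / 2 = t at *
  field_simp
  ring

lemma tsum_altTerm_sub {q A : ℂ} (hq : ‖q‖ < 1) (hA : ∀ n : ℕ, 1 - A * q * q ^ n ≠ 0)
    (h1 : Summable (altTerm q A)) (h2 : Summable (altTerm q (A * q))) :
    ∑' n, altTerm q A n - ∑' n, altTerm q (A * q) n = A * q / (1 - A * q) := by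
  rw [← h1.tsum_sub h2]
  have hpow : Tendsto (fun n : ℕ ↦ 1 - q ^ (n + 1)) atTop (𝓝 (1 - 0)) :=
    tendsto_const_nhds.sub ((tendsto_pow_atTop_nhds_zero_of_norm_lt_one hq).comp
      (tendsto_add_atTop_nat 1))
  have hlim : Tendsto (fun n ↦ altTerm q A n * (1 - q ^ (n + 1))) atTop (𝓝 0) := by
    simpa using h1.tendsto_atTop_zero.mul hpow
  have hpart := (h1.sub h2).tendsto_sum_tsum_nat
  simp only [altTerm_sub_altTerm_mul hq hA, Finset.sum_range_sub'
    (fun n ↦ altTerm q A n * (1 - q ^ (n + 1)))] at hpart ⊢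
  rw [tendsto_nhds_unique hpart (tendsto_const_nhds.sub hlim)]
  have hq1 : 1 - q ≠ 0 := by simpa using one_sub_pow_succ_ne_zero hq 0
  have h0 : 1 - A * q ≠ 0 := by simpa using hA 0
  simp [altTerm, qPoch]
  field_simp

lemma tsum_lambertTerm_sub {q A : ℂ} (hq : ‖q‖ < 1) (hA : ‖A‖ ≤ 1)
    (h1 : Summable (lambertTerm q A)) (h2 : Summable (lambertTerm q (A * q))) :
    ∑' n, lambertTerm q A n - ∑' n, lambertTerm q (A * q) n = A * q / (1 - A * q) := by
  rw [← h1.tsum_sub h2]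
  have hterm (n : ℕ) : lambertTerm q A n - lambertTerm q (A * q) n = A * q * (A * q) ^ n := by
    have := one_sub_pow_succ_ne_zero hq n
    simp only [lambertTerm]
    field_simp
    ring
  have hAq : ‖A * q‖ < 1 := by
    rw [norm_mul]
    nlinarith [norm_nonneg q, norm_nonneg A]
  simp only [hterm, tsum_mul_left, tsum_geometric_of_norm_lt_one hAq, div_eq_mul_inv]

lemma eq_zero_of_succ_eq_of_norm_le_geometric {E : Type*} [NormedAddCommGroup E] {S : ℕ → E}
    {C r : ℝ} (hr0 : 0 ≤ r) (hr : r < 1) (hS : ∀ m, S m = S (m + 1))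
    (hle : ∀ m, ‖S m‖ ≤ C * r ^ m) : S 0 = 0 := by
  have hconst (m : ℕ) : S m = S 0 := by
    induction m with
    | zero => rfl
    | succ m ih => rw [← hS, ih]
  have hlim : Tendsto (fun m : ℕ ↦ C * r ^ m) atTop (𝓝 0) := by
    simpa using (tendsto_pow_atTop_nhds_zero_of_lt_one hr0 hr).const_mul C
  have h : ‖S 0‖ ≤ 0 := ge_of_tendsto' hlim fun m ↦ hconst m ▸ hle m
  exact norm_le_zero_iff.mp h

theorem stmt13 (q a : ℂ) (hq : ‖q‖ < 1) (haa : ‖a‖ ≤ 1)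
    (ha : ∀ n : ℕ, 1 - a * q ^ (n + 1) ≠ 0) :
    ∑' n : ℕ, ((-1 : ℂ) ^ n * a ^ (n + 1) * q ^ ((n + 1) * (n + 2) / 2)) /
        ((1 - q ^ (n + 1)) * qPoch q (a * q) (n + 1))
      = ∑' n : ℕ, a ^ (n + 1) * q ^ (n + 1) / (1 - q ^ (n + 1)) := by
  have ha' (n : ℕ) : 1 - a * q * q ^ n ≠ 0 := by
    have := ha n
    rwa [pow_succ', ← mul_assoc] at this
  obtain ⟨K, hK0, hK⟩ := exists_norm_inv_qPoch_le hq ha'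
  have hnorm (m : ℕ) : ‖a * q ^ m‖ ≤ ‖q‖ ^ m := by
    rw [norm_mul, norm_pow]
    exact mul_le_of_le_one_left (by positivity) haa
  have hnorm1 (m : ℕ) : ‖a * q ^ m‖ ≤ 1 :=
    (hnorm m).trans (pow_le_one₀ (norm_nonneg q) hq.le)
  have hKm (m n : ℕ) : ‖(qPoch q (a * q ^ m * q) n)⁻¹‖ ≤ K := by
    rw [mul_right_comm]
    exact hK m n
  have ham (m n : ℕ) : 1 - a * q ^ m * q * q ^ n ≠ 0 := by
    have := ha' (m + n)
    rwa [pow_add, ← mul_assoc, mul_right_comm a q] at this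
  have hgeom := hasSum_geometric_of_lt_one (norm_nonneg q) hq
  have hle1 (m n : ℕ) := norm_altTerm_le hq (hnorm1 m) hK0 (hKm m) n
  have hle2 (m n : ℕ) := norm_lambertTerm_le hq (hnorm1 m) n
  have hs1 (m : ℕ) : Summable (altTerm q (a * q ^ m)) :=
    .of_norm_bounded (hgeom.summable.mul_left _) (hle1 m)
  have hs2 (m : ℕ) : Summable (lambertTerm q (a * q ^ m)) :=
    .of_norm_bounded (hgeom.summable.mul_left _) (hle2 m)
  have hinv : 0 ≤ (1 - ‖q‖)⁻¹ := inv_nonneg.mpr (by linarith)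
  have hdiv : 0 ≤ K / (1 - ‖q‖) := div_nonneg hK0 (by linarith)
  have key := eq_zero_of_succ_eq_of_norm_le_geometric
    (S := fun m ↦ ∑' n, altTerm q (a * q ^ m) n - ∑' n, lambertTerm q (a * q ^ m) n)
    (C := (K / (1 - ‖q‖) + (1 - ‖q‖)⁻¹) * (1 - ‖q‖)⁻¹) (norm_nonneg q) hq
    (fun m ↦ by
      have e : a * q ^ (m + 1) = a * q ^ m * q := by rw [pow_succ, mul_assoc]
      have h1 := tsum_altTerm_sub hq (ham m) (hs1 m) (e ▸ hs1 (m + 1))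
      have h2 := tsum_lambertTerm_sub hq (hnorm1 m) (hs2 m) (e ▸ hs2 (m + 1))
      simp only [e]
      linear_combination h1 - h2)
    (fun m ↦ by
      have h1 := tsum_of_norm_bounded (hgeom.mul_left _) (hle1 m)
      have h2 := tsum_of_norm_bounded (hgeom.mul_left _) (hle2 m)
      calc _ ≤ _ := norm_sub_le _ _
        _ ≤ _ := add_le_add h1 h2
        _ = ‖a * q ^ m‖ * ((K / (1 - ‖q‖) + (1 - ‖q‖)⁻¹) * (1 - ‖q‖)⁻¹) := by ring
        _ ≤ ‖q‖ ^ m * ((K / (1 - ‖q‖) + (1 - ‖q‖)⁻¹) * (1 - ‖q‖)⁻¹) := by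
          gcongr
          exact hnorm m
        _ = _ := mul_comm _ _)
  simpa [altTerm, lambertTerm, sub_eq_zero] using key
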